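/- Let f, g and h be entire functions given by everywhere absolutely convergent vector valued Dirichlet series, and let p ≥ 0, q ≥ 0, m ≥ 0 be integers. Assume 0 < λ_h^{(m,q)}(f) ≤ ρ_h^{(m,q)}(f) < +∞, 0 < λ_h^{(m,p)}(g) ≤ ρ_h^{(m,p)}(g) < +∞, and that the indicators τ_h^{(m,q)}(f), τ̄_h^{(m,q)}(f), τ_h^{(m,p)}(g), τ̄_h^{(m,p)}(g), Δ_h^{(m,p)}(g), Δ̄_h^{(m,p)}(g) are all positive and finite. Then Δ̄_g^{(p,q)}(f) ≤ min{ (τ_h^{(m,q)}(f)/τ_h^{(m,p)}(g))^{1/λ_h^{(m,p)}(g)}, (τ̄_h^{(m,q)}(f)/τ̄_h^{(m,p)}(g))^{1/λ_h^{(m,p)}(g)}, (τ̄_h^{(m,q)}(f)/Δ_h^{(m,p)}(g))^{1/ρ_h^{(m,p)}(g)}, (τ_h^{(m,q)}(f)/Δ̄_h^{(m,p)}(g))^{1/ρ_h^{(m,p)}(g)} }. -/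

import Mathlib

open Filter Topology

noncomputable section

/-- An entire function given by an everywhere absolutely convergent
vector valued Dirichlet series, with coefficients in a Banach space `E`. -/
structure VVDS (E : Type*) [NormedAddCommGroup E] [NormedSpace ℂ E] [CompleteSpace E] where
  a : ℕ → E
  lam : ℕ → ℝ
  lam_pos : ∀ n, 0 < lam n
  lam_strictMono : StrictMono lam
  lam_tendsto : Tendsto lam atTop atTop
  log_index_bound : ∃ D : ℝ, ∀ᶠ n : ℕ in atTop, Real.log (n : ℝ) / lam n ≤ D
  coeff_decay : Tendsto (fun n => Real.log ‖a n‖ / lam n) atTop atBot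
  abs_conv : ∀ s : ℂ, Summable (fun n => Real.exp (s.re * lam n) * ‖a n‖)

variable {E F G : Type*} [NormedAddCommGroup E] [NormedSpace ℂ E] [CompleteSpace E]
  [NormedAddCommGroup F] [NormedSpace ℂ F] [CompleteSpace F]
  [NormedAddCommGroup G] [NormedSpace ℂ G] [CompleteSpace G]

/-- The entire function defined by the vector valued Dirichlet series. -/
def VVDS.toFun (f : VVDS E) (s : ℂ) : E := ∑' n, Complex.exp (s * (f.lam n : ℂ)) • f.a n

/-- The maximum modulus function `M_f(σ) = sup_t ‖f(σ+it)‖`. -/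
def VVDS.M (f : VVDS E) (σ : ℝ) : ℝ := ⨆ t : ℝ, ‖f.toFun ((σ : ℂ) + (t : ℂ) * Complex.I)‖

/-- The inverse function of the maximum modulus function. -/
def VVDS.Minv (f : VVDS E) (y : ℝ) : ℝ := sInf {σ : ℝ | y ≤ f.M σ}

/-- The (p,q)-th relative Ritt order of `f` with respect to `g`. -/
def relRittOrder (p q : ℕ) (f : VVDS E) (g : VVDS F) : EReal :=
  limsup (fun σ : ℝ =>
    ((Real.log^[p] (g.Minv (f.M σ)) / Real.log^[q] σ : ℝ) : EReal)) atTop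

/-- The (p,q)-th relative Ritt lower order of `f` with respect to `g`. -/
def relRittLowerOrder (p q : ℕ) (f : VVDS E) (g : VVDS F) : EReal :=
  liminf (fun σ : ℝ =>
    ((Real.log^[p] (g.Minv (f.M σ)) / Real.log^[q] σ : ℝ) : EReal)) atTop

/-- The (p,q)-th relative Ritt type of `f` with respect to `g`. -/
def relRittType (p q : ℕ) (f : VVDS E) (g : VVDS F) : EReal :=
  limsup (fun σ : ℝ =>
    ((Real.log^[p-1] (g.Minv (f.M σ)) /
      (Real.log^[q-1] σ) ^ (relRittOrder p q f g).toReal : ℝ) : EReal)) atTop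

/-- The (p,q)-th relative Ritt lower type of `f` with respect to `g`. -/
def relRittLowerType (p q : ℕ) (f : VVDS E) (g : VVDS F) : EReal :=
  liminf (fun σ : ℝ =>
    ((Real.log^[p-1] (g.Minv (f.M σ)) /
      (Real.log^[q-1] σ) ^ (relRittOrder p q f g).toReal : ℝ) : EReal)) atTop

/-- The (p,q)-th relative Ritt weak type of `f` with respect to `g`. -/
def relRittWeakType (p q : ℕ) (f : VVDS E) (g : VVDS F) : EReal :=
  liminf (fun σ : ℝ =>
    ((Real.log^[p-1] (g.Minv (f.M σ)) /
      (Real.log^[q-1] σ) ^ (relRittLowerOrder p q f g).toReal : ℝ) : EReal)) atTop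

/-- The growth indicator `τ̄_g^{(p,q)}(f)`. -/
def relRittUpperWeakType (p q : ℕ) (f : VVDS E) (g : VVDS F) : EReal :=
  limsup (fun σ : ℝ =>
    ((Real.log^[p-1] (g.Minv (f.M σ)) /
      (Real.log^[q-1] σ) ^ (relRittLowerOrder p q f g).toReal : ℝ) : EReal)) atTop


theorem VVDS.norm_term (f : VVDS E) (s : ℂ) (n : ℕ) :
    ‖Complex.exp (s * (f.lam n : ℂ)) • f.a n‖ = Real.exp (s.re * f.lam n) * ‖f.a n‖ := by
  rw [norm_smul, Complex.norm_exp]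
  simp

theorem VVDS.summable_term (f : VVDS E) (s : ℂ) :
    Summable (fun n => Complex.exp (s * (f.lam n : ℂ)) • f.a n) := by
  apply Summable.of_norm
  simp_rw [f.norm_term]
  exact f.abs_conv s

theorem VVDS.abs_conv_real (f : VVDS E) (x : ℝ) :
    Summable (fun n => Real.exp (x * f.lam n) * ‖f.a n‖) := by
  simpa using f.abs_conv (x : ℂ)

theorem VVDS.differentiable (f : VVDS E) : Differentiable ℂ f.toFun := by
  intro s
  have hU : IsOpen {z : ℂ | z.re < s.re + 1} := isOpen_lt Complex.continuous_re continuous_const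
  have := Complex.differentiableOn_tsum_of_summable_norm (U := {z : ℂ | z.re < s.re + 1})
    (F := fun n (z : ℂ) => Complex.exp (z * (f.lam n : ℂ)) • f.a n)
    (f.abs_conv_real (s.re + 1)) (fun n => by fun_prop) hU (by
      intro n w hw
      rw [f.norm_term]
      have : w.re < s.re + 1 := hw
      have := f.lam_pos n
      gcongr)
  exact (this s (by simp)).differentiableAt (hU.mem_nhds (by simp))

theorem VVDS.exists_first (f : VVDS E) : ∃ n0, f.a n0 ≠ 0 ∧ ∀ n < n0, f.a n = 0 := by
  have h : ∃ n, f.a n ≠ 0 := by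
    by_contra! hc
    have h1 := f.coeff_decay.eventually (eventually_lt_atBot 0)
    obtain ⟨n, hn⟩ := h1.exists
    simp [hc] at hn
  classical
  exact ⟨Nat.find h, Nat.find_spec h, fun n hn => by simpa using Nat.find_min h hn⟩

/-- normalised function -/
def VVDS.k (f : VVDS E) (l : ℝ) (s : ℂ) : E := Complex.exp (-(s * (l : ℂ))) • f.toFun s

theorem VVDS.norm_k (f : VVDS E) (l : ℝ) (s : ℂ) :
    ‖f.k l s‖ = Real.exp (-(s.re * l)) * ‖f.toFun s‖ := by
  rw [VVDS.k, norm_smul, Complex.norm_exp]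
  simp

theorem VVDS.k_eq (f : VVDS E) (l : ℝ) (s : ℂ) :
    f.k l s = ∑' n, Complex.exp (s * ((f.lam n - l : ℝ) : ℂ)) • f.a n := by
  rw [VVDS.k, VVDS.toFun, ← (f.summable_term s).tsum_const_smul]
  congr 1; ext n
  rw [smul_smul, ← Complex.exp_add]
  congr 2
  push_cast; ring

theorem VVDS.summable_k (f : VVDS E) (l x : ℝ) :
    Summable (fun n => Real.exp (x * (f.lam n - l)) * ‖f.a n‖) := by
  have := (f.abs_conv_real x).mul_left (Real.exp (-(x * l)))
  refine this.congr fun n => ?_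
  rw [← mul_assoc, ← Real.exp_add]
  congr 2; ring

theorem VVDS.k_term_le (f : VVDS E) {n0 : ℕ} (h0 : ∀ n < n0, f.a n = 0) {b : ℝ} {s : ℂ}
    (hs : s.re ≤ b) (n : ℕ) :
    ‖Complex.exp (s * ((f.lam n - f.lam n0 : ℝ) : ℂ)) • f.a n‖
      ≤ Real.exp (b * (f.lam n - f.lam n0)) * ‖f.a n‖ := by
  rcases lt_or_ge n n0 with hn | hn
  · simp [h0 n hn]
  · have h1 : 0 ≤ f.lam n - f.lam n0 := sub_nonneg.2 (f.lam_strictMono.monotone hn)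
    rw [norm_smul, Complex.norm_exp, Complex.re_mul_ofReal]
    gcongr

theorem VVDS.k_bound (f : VVDS E) {n0 : ℕ} (h0 : ∀ n < n0, f.a n = 0) {b : ℝ} {s : ℂ}
    (hs : s.re ≤ b) :
    ‖f.k (f.lam n0) s‖ ≤ ∑' n, Real.exp (b * (f.lam n - f.lam n0)) * ‖f.a n‖ := by
  rw [f.k_eq]
  exact tsum_of_norm_bounded (f.summable_k _ b).hasSum (f.k_term_le h0 hs)

theorem VVDS.k_tendsto (f : VVDS E) {n0 : ℕ} (h0 : ∀ n < n0, f.a n = 0) :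
    Tendsto (fun x : ℝ => f.k (f.lam n0) (x : ℂ)) atBot (𝓝 (f.a n0)) := by
  simp_rw [f.k_eq]
  have : f.a n0 = ∑' n, (if n = n0 then f.a n0 else 0) := by simp
  rw [this]
  refine tendsto_tsum_of_dominated_convergence (f.summable_k (f.lam n0) 0) ?_ ?_
  · intro n
    rcases lt_trichotomy n n0 with hn | hn | hn
    · simp [h0 n hn, hn.ne]
    · simp [hn]
    · simp only [hn.ne', if_false]
      rw [tendsto_zero_iff_norm_tendsto_zero]
      simp_rw [norm_smul, Complex.norm_exp, Complex.re_mul_ofReal, Complex.ofReal_re]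
      have h1 : 0 < f.lam n - f.lam n0 := sub_pos.2 (f.lam_strictMono hn)
      rw [← zero_mul ‖f.a n‖]
      refine Tendsto.mul_const _ (Real.tendsto_exp_atBot.comp ?_)
      exact tendsto_id.atBot_mul_const h1
  · filter_upwards [eventually_le_atBot 0] with x hx n
    exact f.k_term_le h0 (by simpa using hx) n

theorem VVDS.bdd (f : VVDS E) (σ : ℝ) :
    BddAbove (Set.range fun t : ℝ => ‖f.toFun ((σ : ℂ) + (t : ℂ) * Complex.I)‖) := by
  refine ⟨∑' n, Real.exp (σ * f.lam n) * ‖f.a n‖, ?_⟩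
  rintro _ ⟨t, rfl⟩
  refine tsum_of_norm_bounded (f.abs_conv_real σ).hasSum fun n => ?_
  rw [f.norm_term]; simp

theorem VVDS.le_M (f : VVDS E) (s : ℂ) : ‖f.toFun s‖ ≤ f.M s.re := by
  have := le_ciSup (f.bdd s.re) s.im
  simpa [VVDS.M] using this

theorem VVDS.M_nonneg (f : VVDS E) (σ : ℝ) : 0 ≤ f.M σ :=
  Real.iSup_nonneg fun _ => norm_nonneg _

theorem VVDS.k_mono (f : VVDS E) {n0 : ℕ} (h0 : ∀ n < n0, f.a n = 0) {x y : ℝ} (hxy : x ≤ y) :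
    Real.exp (-(x * f.lam n0)) * f.M x ≤ Real.exp (-(y * f.lam n0)) * f.M y := by
  have hd : Differentiable ℂ (fun z : ℂ => f.k (f.lam n0) ((y : ℂ) - z)) := by
    have := f.differentiable
    unfold VVDS.k
    fun_prop
  set C := ∑' n, Real.exp (y * (f.lam n - f.lam n0)) * ‖f.a n‖
  have hb : ∀ z : ℂ, 0 ≤ z.re → ‖f.k (f.lam n0) ((y : ℂ) - z)‖ ≤ C := fun z hz =>
    f.k_bound h0 (by simpa using hz)
  have key : ∀ z : ℂ, 0 ≤ z.re → ‖f.k (f.lam n0) ((y : ℂ) - z)‖ ≤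
      Real.exp (-(y * f.lam n0)) * f.M y := by
    intro z hz
    refine PhragmenLindelof.right_half_plane_of_bounded_on_real
      (f := fun z : ℂ => f.k (f.lam n0) ((y : ℂ) - z)) hd.diffContOnCl
      ⟨1, by norm_num, 0, ?_⟩ ?_ ?_ hz
    · refine Asymptotics.IsBigO.of_bound C ?_
      rw [eventually_inf_principal]
      refine Eventually.of_forall fun z hz => ?_
      have hz : 0 < z.re := hz
      simpa using hb z hz.le
    · refine ⟨C, ?_⟩
      rw [eventually_map]
      filter_upwards [eventually_ge_atTop 0] with t ht
      exact hb t (by simpa using ht)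
    · intro t
      rw [f.norm_k]
      have := f.le_M ((y : ℂ) - t * Complex.I)
      simp at this ⊢
      gcongr
  have : f.M x ≤ Real.exp (x * f.lam n0) * (Real.exp (-(y * f.lam n0)) * f.M y) := by
    refine ciSup_le fun t => ?_
    have := key ((y - x : ℝ) - t * Complex.I) (by simpa using hxy)
    rw [f.norm_k] at this
    have e : ((y : ℂ) - (((y - x : ℝ) : ℂ) - t * Complex.I)) = (x : ℂ) + t * Complex.I := by
      push_cast; ring
    rw [e] at this
    simp only [Complex.add_re, Complex.ofReal_re, Complex.re_ofReal_mul, Complex.I_re, mul_zero,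
      add_zero] at this
    rw [Real.exp_neg, inv_mul_le_iff₀ (Real.exp_pos _)] at this
    exact this
  rw [Real.exp_neg, inv_mul_le_iff₀ (Real.exp_pos _)]
  exact this

theorem VVDS.M_pos (f : VVDS E) (σ : ℝ) : 0 < f.M σ := by
  obtain ⟨n0, hn0, h0⟩ := f.exists_first
  have h1 : ∀ᶠ x : ℝ in atBot, f.k (f.lam n0) (x : ℂ) ≠ 0 :=
    (f.k_tendsto h0).eventually_ne hn0
  obtain ⟨x, hx, hxs⟩ := (h1.and (eventually_le_atBot σ)).exists
  have h2 := f.k_mono h0 hxs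
  have h3 : 0 < ‖f.k (f.lam n0) (x : ℂ)‖ := norm_pos_iff.2 hx
  rw [f.norm_k] at h3
  have h4 := f.le_M x
  simp only [Complex.ofReal_re] at h3 h4
  have h5 : 0 < Real.exp (-(σ * f.lam n0)) * f.M σ :=
    h3.trans_le ((by gcongr : _ ≤ _).trans h2)
  exact pos_of_mul_pos_right h5 (Real.exp_pos _).le

theorem VVDS.M_strictMono (f : VVDS E) : StrictMono f.M := by
  intro x y hxy
  obtain ⟨n0, hn0, h0⟩ := f.exists_first
  have h1 := f.k_mono h0 hxy.le
  rw [Real.exp_neg, inv_mul_le_iff₀ (Real.exp_pos _), ← mul_assoc, ← Real.exp_add] at h1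
  have h2 : Real.exp (x * f.lam n0 + -(y * f.lam n0)) < 1 := by
    rw [Real.exp_lt_one_iff]
    nlinarith [f.lam_pos n0]
  have := f.M_pos y
  nlinarith

theorem VVDS.M_atTop (f : VVDS E) : Tendsto f.M atTop atTop := by
  obtain ⟨n0, hn0, h0⟩ := f.exists_first
  have : Tendsto (fun x : ℝ => Real.exp (x * f.lam n0) * f.M 0) atTop atTop :=
    (Real.tendsto_exp_atTop.comp (tendsto_id.atTop_mul_const (f.lam_pos n0))).atTop_mul_const
      (f.M_pos 0)
  refine tendsto_atTop_mono' _ ?_ this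
  filter_upwards [eventually_ge_atTop 0] with x hx
  have h1 := f.k_mono h0 hx
  rw [Real.exp_neg (x * _), le_inv_mul_iff₀ (Real.exp_pos _)] at h1
  simpa using h1

theorem VVDS.M_atBot (f : VVDS E) : Tendsto f.M atBot (𝓝 0) := by
  obtain ⟨n0, hn0, h0⟩ := f.exists_first
  have : Tendsto (fun x : ℝ => Real.exp (x * f.lam n0) * f.M 0) atBot (𝓝 (0 * f.M 0)) :=
    (Real.tendsto_exp_atBot.comp (tendsto_id.atBot_mul_const (f.lam_pos n0))).mul_const _
  rw [zero_mul] at this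
  refine tendsto_of_tendsto_of_tendsto_of_le_of_le' tendsto_const_nhds this
    (Eventually.of_forall f.M_nonneg) ?_
  filter_upwards [eventually_le_atBot 0] with x hx
  have h1 := f.k_mono h0 hx
  rw [Real.exp_neg (x * _), inv_mul_le_iff₀ (Real.exp_pos _)] at h1
  simpa using h1

theorem VVDS.M_le_add (f : VVDS E) (x y : ℝ) : f.M x ≤ f.M y +
    ∑' n, |Real.exp (x * f.lam n) - Real.exp (y * f.lam n)| * ‖f.a n‖ := by
  have hs : Summable fun n => |Real.exp (x * f.lam n) - Real.exp (y * f.lam n)| * ‖f.a n‖ := by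
    refine Summable.of_nonneg_of_le (fun n => by positivity) (fun n => ?_)
      ((f.abs_conv_real x).add (f.abs_conv_real y))
    rw [← add_mul]
    gcongr
    refine (abs_sub _ _).trans ?_
    simp
  refine ciSup_le fun t => ?_
  have h1 : f.toFun (x + t * Complex.I) = f.toFun (y + t * Complex.I) +
      (f.toFun (x + t * Complex.I) - f.toFun (y + t * Complex.I)) := by abel
  rw [h1]
  refine (norm_add_le _ _).trans (add_le_add ?_ ?_)
  · simpa using f.le_M (y + t * Complex.I)
  · rw [VVDS.toFun, VVDS.toFun, ← (f.summable_term _).tsum_sub (f.summable_term _)]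
    refine tsum_of_norm_bounded hs.hasSum fun n => ?_
    rw [← sub_smul, norm_smul]
    gcongr
    rw [add_mul, add_mul, Complex.exp_add, Complex.exp_add, ← sub_mul, norm_mul]
    have e1 : ‖Complex.exp (t * Complex.I * f.lam n)‖ = 1 := by
      rw [Complex.norm_exp]; simp
    rw [e1, mul_one, ← Complex.ofReal_mul, ← Complex.ofReal_mul, ← Complex.ofReal_exp,
      ← Complex.ofReal_exp, ← Complex.ofReal_sub, Complex.norm_real, Real.norm_eq_abs]

theorem VVDS.M_continuous (f : VVDS E) : Continuous f.M := by
  rw [continuous_iff_continuousAt]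
  intro y
  have hD : Tendsto (fun x : ℝ => ∑' n, |Real.exp (x * f.lam n) - Real.exp (y * f.lam n)| * ‖f.a n‖)
      (𝓝 y) (𝓝 (∑' n : ℕ, (0 : ℝ))) := by
    refine tendsto_tsum_of_dominated_convergence
      ((f.abs_conv_real (y+1)).add (f.abs_conv_real y)) ?_ ?_
    · intro n
      have : Continuous fun x : ℝ => |Real.exp (x * f.lam n) - Real.exp (y * f.lam n)| * ‖f.a n‖ := by
        fun_prop
      simpa using this.tendsto y
    · filter_upwards [eventually_lt_nhds (lt_add_one y)] with x hx n
      rw [← add_mul, Real.norm_of_nonneg (by positivity)]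
      have := f.lam_pos n
      gcongr
      refine (abs_sub _ _).trans ?_
      simp only [Real.abs_exp]
      gcongr
  rw [tsum_zero] at hD
  rw [ContinuousAt, tendsto_iff_dist_tendsto_zero]
  refine squeeze_zero (fun _ => dist_nonneg) (fun x => ?_) hD
  have h1 := f.M_le_add x y
  have h2 := f.M_le_add y x
  simp_rw [abs_sub_comm (Real.exp (y * _))] at h2
  rw [Real.dist_eq, abs_le]
  constructor <;> linarith

theorem VVDS.M_surj (f : VVDS E) {y : ℝ} (hy : 0 < y) : ∃ σ, f.M σ = y := by
  obtain ⟨a, ha⟩ := (f.M_atBot.eventually (eventually_lt_nhds hy)).exists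
  obtain ⟨b, hb⟩ := (f.M_atTop.eventually (eventually_ge_atTop y)).exists
  exact mem_range_of_exists_le_of_exists_ge f.M_continuous ⟨a, ha.le⟩ ⟨b, hb⟩

theorem VVDS.Minv_M (f : VVDS E) (σ : ℝ) : f.Minv (f.M σ) = σ := by
  have : {x : ℝ | f.M σ ≤ f.M x} = Set.Ici σ := by
    ext x
    simp [f.M_strictMono.le_iff_le]
  rw [VVDS.Minv, this, csInf_Ici]

theorem VVDS.M_Minv (f : VVDS E) {y : ℝ} (hy : 0 < y) : f.M (f.Minv y) = y := by
  obtain ⟨σ, rfl⟩ := f.M_surj hy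
  rw [f.Minv_M]

theorem VVDS.comp_map (f : VVDS E) (g : VVDS F) :
    Filter.map (fun σ => g.Minv (f.M σ)) atTop = atTop := by
  have h1 : StrictMono (fun σ => g.Minv (f.M σ)) := by
    intro x y hxy
    apply g.M_strictMono.lt_iff_lt.1
    rw [g.M_Minv (f.M_pos _), g.M_Minv (f.M_pos _)]
    exact f.M_strictMono hxy
  have h2 : Function.Surjective (fun σ => g.Minv (f.M σ)) := by
    intro y
    obtain ⟨x, hx⟩ := f.M_surj (g.M_pos y)
    exact ⟨x, by simp only [hx, g.Minv_M]⟩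
  exact (h1.orderIsoOfSurjective _ h2).map_atTop

theorem VVDS.comp_comp (f : VVDS E) (g : VVDS F) (h : VVDS G) (σ : ℝ) :
    h.Minv (g.M (g.Minv (f.M σ))) = h.Minv (f.M σ) := by
  rw [g.M_Minv (f.M_pos _)]

theorem iter_log_atTop (n : ℕ) : Tendsto (Real.log^[n]) atTop atTop := by
  induction n with
  | zero => exact tendsto_id
  | succ n ih =>
    rw [Function.iterate_succ']
    exact Real.tendsto_log_atTop.comp ih

theorem ev_between (u : ℝ → ℝ) (h1 : (0 : EReal) < liminf (fun σ => ((u σ : ℝ) : EReal)) atTop)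
    (h2 : limsup (fun σ => ((u σ : ℝ) : EReal)) atTop < ⊤) :
    ∃ c d : ℝ, 0 < c ∧ ∀ᶠ σ in atTop, c < u σ ∧ u σ < d := by
  obtain ⟨c, hc0, hc⟩ := EReal.lt_iff_exists_real_btwn.1 h1
  obtain ⟨d, hd0, hd⟩ := EReal.lt_iff_exists_real_btwn.1 h2
  refine ⟨c, d, by exact_mod_cast hc0, ?_⟩
  filter_upwards [eventually_lt_of_lt_liminf hc, eventually_lt_of_limsup_lt hd0] with σ h3 h4
  exact ⟨by exact_mod_cast h3, by exact_mod_cast h4⟩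

theorem log_ratio {u x : ℝ → ℝ} {a c d : ℝ} (hx : Tendsto x atTop atTop) (hc : 0 < c)
    (h : ∀ᶠ σ in atTop, c < u σ / x σ ^ a ∧ u σ / x σ ^ a < d) :
    Tendsto (fun σ => Real.log (u σ) / Real.log (x σ)) atTop (𝓝 a) := by
  have hl : Tendsto (fun σ => Real.log (x σ)) atTop atTop := Real.tendsto_log_atTop.comp hx
  have h1 : Tendsto (fun σ => Real.log c / Real.log (x σ) + a) atTop (𝓝 (0 + a)) :=
    (hl.const_div_atTop _).add_const _
  have h2 : Tendsto (fun σ => Real.log d / Real.log (x σ) + a) atTop (𝓝 (0 + a)) :=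
    (hl.const_div_atTop _).add_const _
  rw [zero_add] at h1 h2
  have key : ∀ᶠ σ in atTop, Real.log c / Real.log (x σ) + a ≤ Real.log (u σ) / Real.log (x σ) ∧
      Real.log (u σ) / Real.log (x σ) ≤ Real.log d / Real.log (x σ) + a := by
    filter_upwards [h, hx.eventually_gt_atTop 0, hl.eventually_gt_atTop 0] with σ h3 h4 h5
    have hp : 0 < x σ ^ a := Real.rpow_pos_of_pos h4 a
    have hq : 0 < u σ / x σ ^ a := hc.trans h3.1
    have e : u σ = (u σ / x σ ^ a) * x σ ^ a := by field_simp
    have e2 : Real.log (u σ) / Real.log (x σ) =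
        Real.log (u σ / x σ ^ a) / Real.log (x σ) + a := by
      conv_lhs => rw [e, Real.log_mul hq.ne' hp.ne', Real.log_rpow h4]
      field_simp
    rw [e2]
    have l1 := Real.log_le_log hc h3.1.le
    have l2 := Real.log_le_log hq h3.2.le
    constructor <;> gcongr
  exact tendsto_of_tendsto_of_tendsto_of_le_of_le' h1 h2 (key.mono fun _ h => h.1)
    (key.mono fun _ h => h.2)

theorem exp_one {u : ℝ → ℝ} {a c d c' d' : ℝ} (hc : 0 < c) (hc' : 0 < c')
    (h : ∀ᶠ σ in atTop, c < u σ / σ ∧ u σ / σ < d)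
    (h' : ∀ᶠ σ in atTop, c' < u σ / σ ^ a ∧ u σ / σ ^ a < d') : a = 1 := by
  refine tendsto_nhds_unique (log_ratio tendsto_id hc' h') (log_ratio (d := d) tendsto_id hc ?_)
  simpa using h

theorem log_div_self {x : ℝ → ℝ} (hx : Tendsto x atTop atTop) :
    Tendsto (fun σ => Real.log (x σ) / x σ) atTop (𝓝 0) := by
  have := Real.isLittleO_log_id_atTop.tendsto_div_nhds_zero
  exact this.comp hx

theorem classify {u : ℝ → ℝ} {m q : ℕ} {a c d c' d' : ℝ} (ha : 0 < a) (hc : 0 < c) (hc' : 0 < c')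
    (h : ∀ᶠ σ in atTop, c < Real.log^[m] (u σ) / Real.log^[q] σ ∧
      Real.log^[m] (u σ) / Real.log^[q] σ < d)
    (h' : ∀ᶠ σ in atTop, c' < Real.log^[m-1] (u σ) / (Real.log^[q-1] σ) ^ a ∧
      Real.log^[m-1] (u σ) / (Real.log^[q-1] σ) ^ a < d') :
    (m = 0 ∧ q = 0 ∧ a = 1) ∨ (m ≠ 0 ∧ q ≠ 0 ∧
      Tendsto (fun σ => Real.log^[m] (u σ) / Real.log^[q] σ) atTop (𝓝 a)) := by
  have hL := log_ratio (iter_log_atTop (q-1)) hc' h'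
  rcases m with _ | m <;> rcases q with _ | q
  · exact Or.inl ⟨rfl, rfl, exp_one hc hc' h h'⟩
  · exfalso
    simp only [Nat.zero_sub, Function.iterate_zero, id_eq, Nat.add_sub_cancel] at hL h
    have hx := iter_log_atTop (q+1)
    have h1 : Tendsto (fun σ => Real.log (u σ) / Real.log (Real.log^[q+1] σ)) atTop (𝓝 1) :=
      log_ratio (d := d) hx hc (by simpa using h)
    have h2 := h1.mul (log_div_self hx)
    have h3 := tendsto_nhds_unique (h2.congr' ?_) hL
    · simp at h3; exact ha.ne h3
    · filter_upwards [(Real.tendsto_log_atTop.comp hx).eventually_gt_atTop 0] with σ h5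
      simp only [Function.comp] at h5
      rw [div_mul_div_cancel₀ h5.ne', Function.iterate_succ_apply']
  · exfalso
    simp only [Nat.zero_sub, Function.iterate_zero, id_eq, Nat.add_sub_cancel] at hL h
    have h2 := hL.mul (log_div_self tendsto_id)
    simp only [mul_zero, id_eq] at h2
    have h3 := h2.eventually (eventually_lt_nhds hc)
    obtain ⟨σ, h4, h5, h6⟩ := (h3.and (h.and (eventually_gt_atTop 1))).exists
    rw [div_mul_div_cancel₀ (Real.log_pos h6).ne', ← Function.iterate_succ_apply' Real.log] at h4
    linarith [h5.1]
  · right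
    refine ⟨by simp, by simp, ?_⟩
    simp only [Nat.add_sub_cancel] at hL
    simp only [Function.iterate_succ_apply']
    exact hL

theorem core {x Y : ℝ → ℝ} {lf lg r A B : ℝ} (hlg : 0 < lg) (hr : lf / lg ≤ r)
    (hA : 0 < A) (hB : 0 < B) (hY : ∀ᶠ σ in atTop, 1 ≤ x σ ∧ 0 < Y σ)
    (h : ∀ a b, A < a → b < B → ∃ᶠ σ in atTop, b * Y σ ^ lg < a * x σ ^ lf) :
    liminf (fun σ => ((Y σ / x σ ^ r : ℝ) : EReal)) atTop ≤ (((A / B) ^ (1 / lg) : ℝ) : EReal) := by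
  by_contra! hcon
  obtain ⟨C, hC1, hC2⟩ := EReal.lt_iff_exists_real_btwn.1 hcon
  have hC1 : (A / B) ^ (1 / lg) < C := by exact_mod_cast hC1
  have hAB : 0 < A / B := div_pos hA hB
  have hC : 0 < C := (Real.rpow_pos_of_pos hAB _).trans hC1
  have h1 : A / B < C ^ lg := by
    have := Real.rpow_lt_rpow (Real.rpow_pos_of_pos hAB _).le hC1 hlg
    rwa [← Real.rpow_mul hAB.le, one_div_mul_cancel hlg.ne', Real.rpow_one] at this
  have hD : 0 < C ^ lg := Real.rpow_pos_of_pos hC _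
  set D := C ^ lg with hDdef
  rw [div_lt_iff₀ hB] at h1
  obtain ⟨a, ha1, ha2⟩ := exists_between h1
  have h2 : a / D < B := by rw [div_lt_iff₀ hD]; linarith
  obtain ⟨b, hb1, hb2⟩ := exists_between h2
  have hb0 : 0 < b := (div_pos (hA.trans ha1) hD).trans hb1
  rw [div_lt_iff₀ hD] at hb1
  obtain ⟨σ, h3, h4, h5, h6⟩ :=
    ((h a b ha1 hb2).and_eventually ((eventually_lt_of_lt_liminf hC2).and hY)).exists
  have h4 : C < Y σ / x σ ^ r := by exact_mod_cast h4
  have hx0 : 0 < x σ := by linarith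
  rw [lt_div_iff₀ (Real.rpow_pos_of_pos hx0 _)] at h4
  have h7 := Real.rpow_lt_rpow (by positivity) h4 hlg
  rw [Real.mul_rpow hC.le (by positivity), ← Real.rpow_mul hx0.le, ← hDdef] at h7
  have h8 : x σ ^ lf ≤ x σ ^ (r * lg) := by
    apply Real.rpow_le_rpow_of_exponent_le h5
    rwa [div_le_iff₀ hlg] at hr
  have h9 : 0 < x σ ^ lf := Real.rpow_pos_of_pos hx0 _
  have h10 : D * x σ ^ lf < Y σ ^ lg := lt_of_le_of_lt (by gcongr) h7
  have h11 : b * (D * x σ ^ lf) < b * Y σ ^ lg := by gcongr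
  have h12 : a * x σ ^ lf < b * D * x σ ^ lf := by gcongr
  linarith

theorem limsup_coe {u : ℝ → ℝ} {a : ℝ} (h : Tendsto u atTop (𝓝 a)) :
    limsup (fun σ => ((u σ : ℝ) : EReal)) atTop = (a : EReal) :=
  ((continuous_coe_real_ereal.tendsto a).comp h).limsup_eq

theorem coe_of {a : EReal} (h1 : 0 < a) (h2 : a < ⊤) : ((a.toReal : ℝ) : EReal) = a ∧ 0 < a.toReal :=
  ⟨EReal.coe_toReal h2.ne (h1.trans_le' bot_le).ne', EReal.toReal_pos h1 h2.ne⟩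

theorem stmt_15 (f : VVDS E) (g : VVDS F) (h : VVDS G) (p q m : ℕ)
    (hf1 : (0 : EReal) < relRittLowerOrder m q f h)
    (hf2 : relRittLowerOrder m q f h ≤ relRittOrder m q f h)
    (hf3 : relRittOrder m q f h < ⊤)
    (hg1 : (0 : EReal) < relRittLowerOrder m p g h)
    (hg2 : relRittLowerOrder m p g h ≤ relRittOrder m p g h)
    (hg3 : relRittOrder m p g h < ⊤)
    (htf1 : (0 : EReal) < relRittWeakType m q f h)
    (htf2 : relRittWeakType m q f h < ⊤)
    (htbf1 : (0 : EReal) < relRittUpperWeakType m q f h)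
    (htbf2 : relRittUpperWeakType m q f h < ⊤)
    (htg1 : (0 : EReal) < relRittWeakType m p g h)
    (htg2 : relRittWeakType m p g h < ⊤)
    (htbg1 : (0 : EReal) < relRittUpperWeakType m p g h)
    (htbg2 : relRittUpperWeakType m p g h < ⊤)
    (hDg1 : (0 : EReal) < relRittType m p g h)
    (hDg2 : relRittType m p g h < ⊤)
    (hDbg1 : (0 : EReal) < relRittLowerType m p g h)
    (hDbg2 : relRittLowerType m p g h < ⊤)
    :
    relRittLowerType p q f g ≤ ((min (min (((relRittWeakType m q f h).toReal / (relRittWeakType m p g h).toReal) ^ (1 / (relRittLowerOrder m p g h).toReal)) (((relRittUpperWeakType m q f h).toReal / (relRittUpperWeakType m p g h).toReal) ^ (1 / (relRittLowerOrder m p g h).toReal))) (min (((relRittUpperWeakType m q f h).toReal / (relRittType m p g h).toReal) ^ (1 / (relRittOrder m p g h).toReal)) (((relRittWeakType m q f h).toReal / (relRittLowerType m p g h).toReal) ^ (1 / (relRittOrder m p g h).toReal))) : ℝ) : EReal) := by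

  have hH := f.comp_map g
  have hHt : Tendsto (fun σ => g.Minv (f.M σ)) atTop atTop := hH.le
  have hcc := f.comp_comp g h
  obtain ⟨elf, plf⟩ := coe_of hf1 (hf2.trans_lt hf3)
  obtain ⟨elg, plg⟩ := coe_of hg1 (hg2.trans_lt hg3)
  obtain ⟨erg, prg⟩ := coe_of (hg1.trans_le hg2) hg3
  obtain ⟨etf, ptf⟩ := coe_of htf1 htf2
  obtain ⟨etbf, ptbf⟩ := coe_of htbf1 htbf2
  obtain ⟨etg, ptg⟩ := coe_of htg1 htg2
  obtain ⟨etbg, ptbg⟩ := coe_of htbg1 htbg2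
  obtain ⟨c1, d1, hc1, hb1⟩ := ev_between _ hf1 hf3
  obtain ⟨c2, d2, hc2, hb2⟩ := ev_between _ htf1 htbf2
  obtain ⟨c3, d3, hc3, hb3⟩ := ev_between _ hg1 hg3
  obtain ⟨c4, d4, hc4, hb4⟩ := ev_between _ htg1 htbg2
  obtain ⟨c5, d5, hc5, hb5⟩ := ev_between _ hDbg1 hDg2
  have clf := classify plf hc1 hc2 hb1 hb2
  have clg := classify plg hc3 hc4 hb3 hb4
  have clr := classify prg hc3 hc5 hb3 hb5
  -- the order and lower order of `g` coincide
  have hρ : relRittOrder m p g h = relRittLowerOrder m p g h := by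
    rw [← erg, ← elg]
    rcases clg with ⟨h1, h2, h3⟩ | ⟨h1, h2, h3⟩ <;> rcases clr with ⟨h4, h5, h6⟩ | ⟨h4, h5, h6⟩
    · rw [h3, h6]
    · exact absurd h1 h4
    · exact absurd h4 h1
    · rw [tendsto_nhds_unique h3 h6]
  have hT : relRittType m p g h = relRittUpperWeakType m p g h := by
    unfold relRittType relRittUpperWeakType; rw [hρ]
  have hT' : relRittLowerType m p g h = relRittWeakType m p g h := by
    unfold relRittLowerType relRittWeakType; rw [hρ]
  -- the relative order of `f` with respect to `g`
  have hr : (relRittLowerOrder m q f h).toReal / (relRittLowerOrder m p g h).toReal ≤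
      (relRittOrder p q f g).toReal := by
    rcases clf with ⟨h1, h2, h3⟩ | ⟨h1, h2, h3⟩ <;> rcases clg with ⟨h4, h5, h6⟩ | ⟨h4, h5, h6⟩
    · subst h1 h2 h5
      rw [h3, h6, div_one]
      have hρ1 : relRittOrder 0 0 g h = ((1 : ℝ) : EReal) := by rw [hρ, ← elg, h6]
      have hlam1 : relRittLowerOrder 0 0 f h = ((1 : ℝ) : EReal) := by rw [← elf, h3]
      have hlow : ∀ ε : ℝ, 0 < ε → ε < 1 →
          (((1 - ε) / (1 + ε) : ℝ) : EReal) ≤ relRittOrder 0 0 f g := by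
        intro ε h0 h1
        have e1 : ∀ᶠ σ in atTop, (((1 - ε : ℝ)) : EReal) <
            ((Real.log^[0] (h.Minv (f.M σ)) / Real.log^[0] σ : ℝ) : EReal) := by
          refine eventually_lt_of_lt_liminf ?_
          change _ < relRittLowerOrder 0 0 f h
          rw [hlam1]
          exact_mod_cast (by linarith : 1 - ε < 1)
        have e2 : ∀ᶠ σ in atTop,
            ((Real.log^[0] (h.Minv (g.M σ)) / Real.log^[0] σ : ℝ) : EReal)
              < (((1 + ε : ℝ)) : EReal) := by
          refine eventually_lt_of_limsup_lt ?_
          change relRittOrder 0 0 g h < _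
          rw [hρ1]
          exact_mod_cast (by linarith : 1 < 1 + ε)
        have e3 := hHt.eventually e2
        have e4 : ∀ᶠ σ in atTop, (((1 - ε) / (1 + ε) : ℝ) : EReal) ≤
            ((Real.log^[0] (g.Minv (f.M σ)) / Real.log^[0] σ : ℝ) : EReal) := by
          filter_upwards [e1, e3, eventually_gt_atTop 0, hHt.eventually_gt_atTop 0]
            with σ i1 i2 i3 i4
          rw [hcc] at i2
          simp only [Function.iterate_zero, id_eq, EReal.coe_lt_coe_iff, EReal.coe_le_coe_iff]
            at i1 i2 ⊢
          rw [lt_div_iff₀ i3] at i1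
          rw [div_lt_iff₀ i4] at i2
          rw [div_le_div_iff₀ (by linarith) i3]
          linarith
        exact (le_liminf_of_le (h := e4)).trans liminf_le_limsup
      have hup : relRittOrder 0 0 f g < ⊤ := by
        have e3 := hHt.eventually hb3
        have e4 : ∀ᶠ σ in atTop,
            ((Real.log^[0] (g.Minv (f.M σ)) / Real.log^[0] σ : ℝ) : EReal)
              ≤ ((d1 / c3 : ℝ) : EReal) := by
          filter_upwards [hb1, e3, eventually_gt_atTop 0, hHt.eventually_gt_atTop 0]
            with σ i1 i2 i3 i4
          rw [hcc] at i2
          replace i1 := i1.2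
          replace i2 := i2.1
          simp only [Function.iterate_zero, id_eq, EReal.coe_le_coe_iff] at i1 i2 ⊢
          rw [div_lt_iff₀ i3] at i1
          rw [lt_div_iff₀ i4] at i2
          rw [div_le_div_iff₀ i3 hc3]
          linarith
        exact (limsup_le_of_le (h := e4)).trans_lt (EReal.coe_lt_top _)
      have hbot : relRittOrder 0 0 f g ≠ ⊥ := by
        have := hlow (1/2) (by norm_num) (by norm_num)
        exact ((EReal.bot_lt_coe _).trans_le this).ne'
      have ht : Tendsto (fun ε : ℝ => (1 - ε) / (1 + ε)) (𝓝[>] 0) (𝓝 1) := by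
        have : ContinuousAt (fun ε : ℝ => (1 - ε) / (1 + ε)) 0 := by
          apply ContinuousAt.div <;> first | fun_prop | simp
        have := this.tendsto
        simp only [sub_zero, add_zero, div_one] at this
        exact this.mono_left nhdsWithin_le_nhds
      refine le_of_tendsto ht ?_
      filter_upwards [Ioo_mem_nhdsGT (zero_lt_one' ℝ)] with ε hε
      have := hlow ε hε.1 hε.2
      rw [← EReal.coe_toReal hup.ne hbot] at this
      exact_mod_cast this
    · exact absurd h1 h4
    · exact absurd h4 h1
    · have h7 := h6.comp hHt
      have h8 := h3.div h7 plg.ne'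
      have h9 : Tendsto (fun σ => Real.log^[p] (g.Minv (f.M σ)) / Real.log^[q] σ) atTop
          (𝓝 ((relRittLowerOrder m q f h).toReal / (relRittLowerOrder m p g h).toReal)) := by
        refine h8.congr' ?_
        filter_upwards [hb1, (iter_log_atTop q).eventually_gt_atTop 0,
          ((iter_log_atTop p).comp hHt).eventually_gt_atTop 0] with σ i1 i2 i3
        have i4 : 0 < Real.log^[m] (h.Minv (f.M σ)) := by
          have := hc1.trans i1.1
          rwa [div_pos_iff_of_pos_right i2] at this
        simp only [Function.comp] at i3
        simp only [Pi.div_apply, Function.comp, hcc]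
        field_simp
      have h10 : relRittOrder p q f g = _ := limsup_coe h9
      rw [h10, EReal.toReal_coe]
  have hY : ∀ᶠ σ in atTop, 1 ≤ Real.log^[q-1] σ ∧ 0 < Real.log^[p-1] (g.Minv (f.M σ)) :=
    ((iter_log_atTop (q-1)).eventually_ge_atTop 1).and
      (((iter_log_atTop (p-1)).comp hHt).eventually_gt_atTop 0)
  have B1 : relRittLowerType p q f g ≤ ((((relRittWeakType m q f h).toReal /
      (relRittWeakType m p g h).toReal) ^ (1 / (relRittLowerOrder m p g h).toReal) : ℝ) : EReal) := by
    refine core plg hr ptf ptg hY fun a b ha hb => ?_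
    have f1 : ∃ᶠ σ in atTop, ((Real.log^[m-1] (h.Minv (f.M σ)) /
        (Real.log^[q-1] σ) ^ (relRittLowerOrder m q f h).toReal : ℝ) : EReal) < (a : EReal) := by
      refine frequently_lt_of_liminf_lt (h := ?_)
      change relRittWeakType m q f h < _
      rw [← etf]; exact_mod_cast ha
    have f2 : ∀ᶠ σ in atTop, (b : EReal) < ((Real.log^[m-1] (h.Minv (g.M σ)) /
        (Real.log^[p-1] σ) ^ (relRittLowerOrder m p g h).toReal : ℝ) : EReal) := by
      refine eventually_lt_of_lt_liminf ?_
      change _ < relRittWeakType m p g h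
      rw [← etg]; exact_mod_cast hb
    refine (f1.and_eventually ((hHt.eventually f2).and hY)).mono ?_
    rintro σ ⟨i1, i2, i3, i4⟩
    rw [hcc] at i2
    have i3' : 0 < Real.log^[q-1] σ := by linarith
    rw [EReal.coe_lt_coe_iff, div_lt_iff₀ (Real.rpow_pos_of_pos i3' _)] at i1
    rw [EReal.coe_lt_coe_iff, lt_div_iff₀ (Real.rpow_pos_of_pos i4 _)] at i2
    exact i2.trans i1
  have B2 : relRittLowerType p q f g ≤ ((((relRittUpperWeakType m q f h).toReal /
      (relRittUpperWeakType m p g h).toReal) ^ (1 / (relRittLowerOrder m p g h).toReal) : ℝ) :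
        EReal) := by
    refine core plg hr ptbf ptbg hY fun a b ha hb => ?_
    have f1 : ∀ᶠ σ in atTop, ((Real.log^[m-1] (h.Minv (f.M σ)) /
        (Real.log^[q-1] σ) ^ (relRittLowerOrder m q f h).toReal : ℝ) : EReal) < (a : EReal) := by
      refine eventually_lt_of_limsup_lt ?_
      change relRittUpperWeakType m q f h < _
      rw [← etbf]; exact_mod_cast ha
    have f2 : ∃ᶠ σ in atTop, (b : EReal) < ((Real.log^[m-1] (h.Minv (g.M σ)) /
        (Real.log^[p-1] σ) ^ (relRittLowerOrder m p g h).toReal : ℝ) : EReal) := by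
      refine frequently_lt_of_lt_limsup (h := ?_)
      change _ < relRittUpperWeakType m p g h
      rw [← etbg]; exact_mod_cast hb
    rw [← hH, frequently_map] at f2
    refine (f2.and_eventually (f1.and hY)).mono ?_
    rintro σ ⟨i2, i1, i3, i4⟩
    rw [hcc] at i2
    have i3' : 0 < Real.log^[q-1] σ := by linarith
    rw [EReal.coe_lt_coe_iff, div_lt_iff₀ (Real.rpow_pos_of_pos i3' _)] at i1
    rw [EReal.coe_lt_coe_iff, lt_div_iff₀ (Real.rpow_pos_of_pos i4 _)] at i2
    exact i2.trans i1
  rw [hT, hT', hρ]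
  rcases min_cases (((relRittWeakType m q f h).toReal / (relRittWeakType m p g h).toReal) ^ (1 / (relRittLowerOrder m p g h).toReal)) (((relRittUpperWeakType m q f h).toReal / (relRittUpperWeakType m p g h).toReal) ^ (1 / (relRittLowerOrder m p g h).toReal)) with ⟨e, -⟩ | ⟨e, -⟩
  · rw [min_comm (((relRittUpperWeakType m q f h).toReal / (relRittUpperWeakType m p g h).toReal) ^ _), min_self, e]
    exact B1
  · rw [min_comm (((relRittUpperWeakType m q f h).toReal / (relRittUpperWeakType m p g h).toReal) ^ _), min_self, e]
    exact B2
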